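/- arXiv:2104.00300 — 2 statements merged into one kernel-verified Lean document; each statement's English description precedes it below -/
import Mathlib

section
/- Let (U, σ) be a catalysis in canonical form: U a unitary on ℂ^{d_A} ⊗ ℂ^{d_B} and σ a density matrix on ℂ^{d_B} with Tr_A(U(ρ ⊗ σ)U†) = σ for every density matrix ρ on ℂ^{d_A}. Let r be any positive integer, let Û denote the unitary on ℂ^r ⊗ ℂ^{d_A} ⊗ ℂ^{d_B} acting as the identity on the first factor and as U on the last two factors, and for a density matrix ρ on ℂ^r ⊗ ℂ^{d_A} set ω = Tr_B(Û(ρ ⊗ σ)Û†). Then |S(ω) − S(ρ)| ≤ 2 S(σ). (The randomness source must have entropy at least half the maximal entropy variance of the implemented map.) -/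
open scoped Matrix Kronecker BigOperators Classical ComplexOrder

/-- A density matrix: positive semidefinite with unit trace. -/
noncomputable def IsDensity {n : Type*} [Fintype n] (ρ : Matrix n n ℂ) : Prop :=
  ρ.PosSemidef ∧ ρ.trace = 1

/-- A unitary matrix. -/
noncomputable def IsUnitary {n : Type*} [Fintype n] [DecidableEq n] (U : Matrix n n ℂ) : Prop :=
  U * Uᴴ = 1 ∧ Uᴴ * U = 1

/-- Partial trace over the first tensor factor. -/
noncomputable def trFst {α β : Type*} [Fintype α] (M : Matrix (α × β) (α × β) ℂ) : Matrix β β ℂ :=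
  Matrix.of fun k l => ∑ i, M (i, k) (i, l)

/-- Partial trace over the second tensor factor. -/
noncomputable def trSnd {α β : Type*} [Fintype β] (M : Matrix (α × β) (α × β) ℂ) : Matrix α α ℂ :=
  Matrix.of fun i j => ∑ k, M (i, k) (j, k)

/-- Partial trace over the third factor of a tripartite system. -/
noncomputable def trThird {α β γ : Type*} [Fintype γ] (M : Matrix (α × β × γ) (α × β × γ) ℂ) :
    Matrix (α × β) (α × β) ℂ :=
  Matrix.of fun p q => ∑ k, M (p.1, p.2, k) (q.1, q.2, k)

/-- von Neumann entropy (base-2), with the convention `0 log 0 = 0`. -/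
noncomputable def vnEntropy {n : Type*} [Fintype n] [DecidableEq n] (ρ : Matrix n n ℂ) : ℝ :=
  if h : ρ.IsHermitian then -∑ i, h.eigenvalues i * Real.logb 2 (h.eigenvalues i) else 0

/-- Largest eigenvalue of a (Hermitian) matrix. -/
noncomputable def maxEig {n : Type*} [Fintype n] [DecidableEq n] (ρ : Matrix n n ℂ) : ℝ :=
  if h : ρ.IsHermitian then ⨆ i, h.eigenvalues i else 0

/-- Min-entropy of a density matrix. -/
noncomputable def minEntropy {n : Type*} [Fintype n] [DecidableEq n] (ρ : Matrix n n ℂ) : ℝ :=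
  -Real.logb 2 (maxEig ρ)

/-- Rényi entropy of order `α` (base 2). -/
noncomputable def renyiEntropy {n : Type*} [Fintype n] [DecidableEq n] (α : ℝ)
    (ρ : Matrix n n ℂ) : ℝ :=
  if h : ρ.IsHermitian then (1 - α)⁻¹ * Real.logb 2 (∑ i, h.eigenvalues i ^ α) else 0

/-- Partial transpose over the first tensor factor. -/
noncomputable def ptFst {α β : Type*} (U : Matrix (α × β) (α × β) ℂ) : Matrix (α × β) (α × β) ℂ :=
  Matrix.of fun p q => U (q.1, p.2) (p.1, q.2)

/-- Swap the two parties of a bipartite matrix. -/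
noncomputable def swapParties {α β : Type*} (U : Matrix (α × β) (α × β) ℂ) : Matrix (β × α) (β × α) ℂ :=
  Matrix.of fun p q => U (p.2, p.1) (q.2, q.1)

/-- `U` is compatible with the catalyst `σ`: there is a unitary `V` on `B` such that
`Tr_A (U (ρ ⊗ σ) U†) = V σ V†` for every density matrix `ρ` on `A`. -/
noncomputable def Compatible {dA dB : ℕ} (U : Matrix (Fin dA × Fin dB) (Fin dA × Fin dB) ℂ)
    (σ : Matrix (Fin dB) (Fin dB) ℂ) : Prop :=
  ∃ V : Matrix (Fin dB) (Fin dB) ℂ, IsUnitary V ∧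
    ∀ ρ : Matrix (Fin dA) (Fin dA) ℂ, IsDensity ρ →
      trFst (U * (ρ ⊗ₖ σ) * Uᴴ) = V * σ * Vᴴ

/-- The unitary `1_m ⊗ U` on `ℂ^m ⊗ ℂ^{dA} ⊗ ℂ^{dB}`, indexed as `(Fin m × Fin dA) × Fin dB`. -/
noncomputable def extUnitary {m dA dB : ℕ} (U : Matrix (Fin dA × Fin dB) (Fin dA × Fin dB) ℂ) :
    Matrix ((Fin m × Fin dA) × Fin dB) ((Fin m × Fin dA) × Fin dB) ℂ :=
  Matrix.of fun p q => if p.1.1 = q.1.1 then U (p.1.2, p.2) (q.1.2, q.2) else 0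

noncomputable def ent (x : ℝ) : ℝ := -(x * Real.logb 2 x)

lemma ent_zero : ent 0 = 0 := by simp [ent]

lemma ent_concave : ConcaveOn ℝ (Set.Ici (0:ℝ)) ent := by
  have h := Real.concaveOn_negMulLog.smul (c := (Real.log 2)⁻¹)
    (inv_nonneg.2 (Real.log_nonneg (by norm_num)))
  have e : ent = fun x => (Real.log 2)⁻¹ • x.negMulLog := by
    funext x
    simp only [ent, Real.logb, Real.negMulLog, smul_eq_mul]
    ring
  rw [e]
  exact h

section Ent
variable {n m : Type*} [Fintype n] [DecidableEq n] [Fintype m] [DecidableEq m]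

lemma vn_eigs {A : Matrix n n ℂ} (h : A.IsHermitian) :
    vnEntropy A = ∑ i, ent (h.eigenvalues i) := by
  simp [vnEntropy, h, ent]

lemma vn_roots {A : Matrix n n ℂ} (h : A.IsHermitian) :
    vnEntropy A = (A.charpoly.roots.map (fun z => ent z.re)).sum := by
  rw [vn_eigs h, h.roots_charpoly_eq_eigenvalues, Multiset.map_map]
  simp

lemma vn_congr {A B : Matrix n n ℂ} (hA : A.IsHermitian) (hB : B.IsHermitian)
    (h : A.charpoly = B.charpoly) : vnEntropy A = vnEntropy B := by
  rw [vn_roots hA, vn_roots hB, h]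

lemma vn_comm (M : Matrix m n ℂ) : vnEntropy (M * Mᴴ) = vnEntropy (Mᴴ * M) := by
  rw [vn_roots (Matrix.isHermitian_mul_conjTranspose_self M),
    vn_roots (Matrix.isHermitian_conjTranspose_mul_self M)]
  have h := congrArg (fun p => (p.roots.map (fun z : ℂ => ent z.re)).sum)
    (Matrix.charpoly_mul_comm' M Mᴴ)
  rw [Polynomial.roots_mul (mul_ne_zero (pow_ne_zero _ Polynomial.X_ne_zero)
      (Matrix.charpoly_monic _).ne_zero),
    Polynomial.roots_mul (mul_ne_zero (pow_ne_zero _ Polynomial.X_ne_zero)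
      (Matrix.charpoly_monic _).ne_zero)] at h
  simpa [Multiset.map_nsmul, Multiset.sum_nsmul, ent_zero] using h

lemma vn_transpose {A : Matrix n n ℂ} (h : A.IsHermitian) : vnEntropy Aᵀ = vnEntropy A :=
  vn_congr h.transpose h (Matrix.charpoly_transpose A)

lemma vn_conj {A W : Matrix n n ℂ} (h : A.IsHermitian) (hW : Wᴴ * W = 1) :
    vnEntropy (W * A * Wᴴ) = vnEntropy A := by
  refine vn_congr (Matrix.isHermitian_mul_mul_conjTranspose W h) h ?_
  rw [Matrix.charpoly_mul_comm, ← mul_assoc, hW, one_mul]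

lemma vn_diag (d : n → ℝ) :
    vnEntropy (Matrix.diagonal (fun i => (d i : ℂ))) = ∑ i, ent (d i) := by
  have h : (Matrix.diagonal (fun i => (d i : ℂ))).IsHermitian := by
    apply Matrix.isHermitian_diagonal_of_self_adjoint
    ext i; simp
  rw [vn_roots h, Matrix.charpoly_diagonal, Polynomial.roots_prod]
  · simp
  · simp [Finset.prod_ne_zero_iff, Polynomial.X_sub_C_ne_zero]

lemma spec {A : Matrix n n ℂ} (h : A.IsHermitian) :
    ∃ (W : Matrix n n ℂ), W * Wᴴ = 1 ∧ Wᴴ * W = 1 ∧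
      A = W * Matrix.diagonal (fun i => (h.eigenvalues i : ℂ)) * Wᴴ := by
  refine ⟨h.eigenvectorUnitary, ?_, ?_, ?_⟩
  · exact Unitary.coe_mul_star_self h.eigenvectorUnitary
  · exact Unitary.coe_star_mul_self h.eigenvectorUnitary
  · conv_lhs => rw [h.spectral_theorem]
    rfl

lemma eig_sum {A : Matrix n n ℂ} (h : IsDensity A) : ∑ i, h.1.isHermitian.eigenvalues i = 1 := by
  have := h.1.isHermitian.trace_eq_sum_eigenvalues
  have h3 := h.2.symm.trans this
  have h4 := congrArg Complex.re h3
  simpa using h4.symm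

lemma vn_kron {A : Matrix n n ℂ} {B : Matrix m m ℂ} (hA : IsDensity A) (hB : IsDensity B) :
    vnEntropy (A ⊗ₖ B) = vnEntropy A + vnEntropy B := by
  have h1 := hA.1.isHermitian
  have h2 := hB.1.isHermitian
  obtain ⟨V, hV1, hV2, hV⟩ := spec h1
  obtain ⟨W, hW1, hW2, hW⟩ := spec h2
  have e : A ⊗ₖ B = (V ⊗ₖ W) * Matrix.diagonal
      (fun x : n × m => ((h1.eigenvalues x.1 * h2.eigenvalues x.2 : ℝ) : ℂ)) * (V ⊗ₖ W)ᴴ := by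
    conv_lhs => rw [hV, hW]
    rw [Matrix.mul_kronecker_mul, Matrix.mul_kronecker_mul, Matrix.diagonal_kronecker_diagonal,
      Matrix.conjTranspose_kronecker]
    simp
  rw [e, vn_conj, vn_diag, vn_eigs h1, vn_eigs h2, Fintype.sum_prod_type]
  · have : ∀ i j, ent (h1.eigenvalues i * h2.eigenvalues j) =
        ent (h1.eigenvalues i) * h2.eigenvalues j + h1.eigenvalues i * ent (h2.eigenvalues j) := by
      intro i j
      by_cases hi : h1.eigenvalues i = 0
      · simp [hi, ent]
      by_cases hj : h2.eigenvalues j = 0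
      · simp [hj, ent]
      simp only [ent, Real.logb_mul hi hj]; ring
    simp_rw [this, Finset.sum_add_distrib, ← Finset.mul_sum, ← Finset.sum_mul]
    rw [eig_sum hA, eig_sum hB]; ring
  · apply Matrix.isHermitian_diagonal_of_self_adjoint
    ext i; simp
  · rw [Matrix.conjTranspose_kronecker, ← Matrix.mul_kronecker_mul, hV2, hW2,
      Matrix.one_kronecker_one]

lemma vn_pinch {A : Matrix n n ℂ} (h : A.PosSemidef) : vnEntropy A ≤ ∑ i, ent (A i i).re := by
  rw [vn_eigs h.isHermitian]
  obtain ⟨W, hW1, hW2, hW⟩ := spec h.isHermitian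
  set d := h.isHermitian.eigenvalues with hd
  have hdn : ∀ i, 0 ≤ d i := h.eigenvalues_nonneg
  have r1 : ∀ i, ∑ k, Complex.normSq (W i k) = 1 := by
    intro i
    have := congrFun (congrFun hW1 i) i
    simp only [Matrix.mul_apply, Matrix.conjTranspose_apply, Matrix.one_apply_eq] at this
    have h3 := congrArg Complex.re this
    simpa [Complex.normSq_apply] using h3
  have r2 : ∀ k, ∑ i, Complex.normSq (W i k) = 1 := by
    intro i
    have := congrFun (congrFun hW2 i) i
    simp only [Matrix.mul_apply, Matrix.conjTranspose_apply, Matrix.one_apply_eq] at this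
    have h3 := congrArg Complex.re this
    simpa [Complex.normSq_apply] using h3
  have e : ∀ i, (A i i).re = ∑ k, Complex.normSq (W i k) * d k := by
    intro i
    rw [hW]
    rw [Matrix.mul_apply]
    simp only [Matrix.mul_diagonal, Matrix.conjTranspose_apply]
    simp [Complex.normSq_apply]
    refine Finset.sum_congr rfl fun k _ => by ring
  calc ∑ k, ent (d k) = ∑ k, ∑ i, Complex.normSq (W i k) * ent (d k) := by
        simp_rw [← Finset.sum_mul, r2, one_mul]
    _ = ∑ i, ∑ k, Complex.normSq (W i k) * ent (d k) := Finset.sum_comm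
    _ ≤ _ := by
        refine Finset.sum_le_sum fun i _ => ?_
        rw [e]
        have := ent_concave.le_map_sum (t := Finset.univ) (w := fun k => Complex.normSq (W i k))
          (p := d) (fun k _ => Complex.normSq_nonneg _) (r1 i) (fun k _ => hdn k)
        simpa using this
end Ent

lemma undiag {n : Type*} [Fintype n] [DecidableEq n] {V D X : Matrix n n ℂ} (h : Vᴴ * V = 1)
    (hX : X = V * D * Vᴴ) : Vᴴ * X * Vᴴᴴ = D := by
  rw [hX, Matrix.conjTranspose_conjTranspose]
  calc _ = (Vᴴ * V) * D * (Vᴴ * V) := by simp only [mul_assoc]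
    _ = D := by rw [h]; simp

lemma factor {n : Type*} [Fintype n] [DecidableEq n] {M : Matrix n n ℂ} (h : M.PosSemidef) :
    ∃ B : Matrix n n ℂ, M = Bᴴ * B := by
  obtain ⟨W, hW1, hW2, hW⟩ := spec h.isHermitian
  refine ⟨(W * Matrix.diagonal (fun i => ((Real.sqrt (h.isHermitian.eigenvalues i) : ℝ) : ℂ)))ᴴ, ?_⟩
  rw [Matrix.conjTranspose_conjTranspose, Matrix.conjTranspose_mul, Matrix.diagonal_conjTranspose,
    mul_assoc, ← mul_assoc (Matrix.diagonal _), Matrix.diagonal_mul_diagonal, ← mul_assoc]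
  refine hW.trans ?_
  congr 3
  funext i
  have := Real.mul_self_sqrt (h.eigenvalues_nonneg i)
  simp only [Pi.star_apply, Complex.star_def, Complex.conj_ofReal]
  exact_mod_cast this.symm

section Sub
variable {α β : Type*} [Fintype α] [DecidableEq α] [Fintype β] [DecidableEq β]

lemma classical_sub (p : α → β → ℝ) (hp : ∀ i j, 0 ≤ p i j) (hs : ∑ i, ∑ j, p i j = 1) :
    ∑ i, ∑ j, ent (p i j) ≤ ∑ i, ent (∑ j, p i j) + ∑ j, ent (∑ i, p i j) := by
  set a := fun i => ∑ j, p i j with ha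
  set b := fun j => ∑ i, p i j with hb
  have hlog : 0 < Real.log 2 := Real.log_pos (by norm_num)
  have key : ∀ i j, ent (p i j) + p i j * Real.logb 2 (a i) + p i j * Real.logb 2 (b j)
      ≤ (a i * b j - p i j) / Real.log 2 := by
    intro i j
    have h1 : p i j ≤ a i := Finset.single_le_sum (f := fun j => p i j)
      (fun j _ => hp i j) (Finset.mem_univ j)
    have h2 : p i j ≤ b j := Finset.single_le_sum (f := fun i => p i j)
      (fun i _ => hp i j) (Finset.mem_univ i)
    have h0 := hp i j
    rw [le_div_iff₀ hlog]
    have e : (ent (p i j) + p i j * Real.logb 2 (a i) + p i j * Real.logb 2 (b j)) * Real.log 2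
      = p i j * (Real.log (a i) + Real.log (b j) - Real.log (p i j)) := by
      simp only [ent, Real.logb]; field_simp; ring
    rw [e]
    rcases h0.eq_or_lt with h | h
    · rw [← h] at h1 h2 ⊢
      have := mul_nonneg h1 h2
      simpa using this
    · have ha' : 0 < a i := by linarith
      have hb' : 0 < b j := by linarith
      rw [← Real.log_mul ha'.ne' hb'.ne', ← Real.log_div (mul_pos ha' hb').ne' h.ne']
      have := Real.log_le_sub_one_of_pos (div_pos (mul_pos ha' hb') h)
      calc _ ≤ p i j * (a i * b j / p i j - 1) := by gcongr
        _ = _ := by field_simp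
  have hsum := Finset.sum_le_sum fun i (_ : i ∈ Finset.univ) =>
    Finset.sum_le_sum fun j (_ : j ∈ Finset.univ) => key i j
  have ea : ∑ i, a i = 1 := hs
  have eb : ∑ j, b j = 1 := by rw [← hs, Finset.sum_comm]
  have s1 : ∑ i, ∑ j, p i j * Real.logb 2 (a i) = -∑ i, ent (a i) := by
    simp only [ent, Finset.sum_neg_distrib, neg_neg, ← Finset.sum_mul]; rfl
  have s2 : ∑ i, ∑ j, p i j * Real.logb 2 (b j) = -∑ j, ent (b j) := by
    rw [Finset.sum_comm]
    simp only [ent, Finset.sum_neg_distrib, neg_neg, ← Finset.sum_mul]; rfl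
  have s3 : ∑ i, ∑ j, (a i * b j - p i j) / Real.log 2 = 0 := by
    have : ∑ i, ∑ j, (a i * b j - p i j) = 0 := by
      have e : ∑ i, ∑ j, a i * b j = 1 := by
        rw [← Finset.sum_mul_sum, ea, eb, one_mul]
      simp only [Finset.sum_sub_distrib]
      rw [e, hs, sub_self]
    simp only [← Finset.sum_div]
    rw [this, zero_div]
  simp_rw [Finset.sum_add_distrib] at hsum
  rw [s1, s2, s3] at hsum
  linarith

lemma trSnd_l (V : Matrix α α ℂ) (M : Matrix (α × β) (α × β) ℂ) :
    trSnd ((V ⊗ₖ (1 : Matrix β β ℂ)) * M) = V * trSnd M := by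
  ext i j
  simp [trSnd, Matrix.mul_apply, Fintype.sum_prod_type, Matrix.one_apply, Finset.mul_sum]
  rw [Finset.sum_comm]

lemma trSnd_r (V : Matrix α α ℂ) (M : Matrix (α × β) (α × β) ℂ) :
    trSnd (M * (V ⊗ₖ (1 : Matrix β β ℂ))) = trSnd M * V := by
  ext i j
  simp [trSnd, Matrix.mul_apply, Fintype.sum_prod_type, Matrix.one_apply, Finset.sum_mul]
  rw [Finset.sum_comm]

lemma trSnd_c (W : Matrix β β ℂ) (M : Matrix (α × β) (α × β) ℂ) :
    trSnd (((1 : Matrix α α ℂ) ⊗ₖ W) * M) = trSnd (M * ((1 : Matrix α α ℂ) ⊗ₖ W)) := by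
  ext i j
  simp [trSnd, Matrix.mul_apply, Fintype.sum_prod_type, Matrix.one_apply]
  rw [Finset.sum_comm]
  simp [mul_comm]

lemma trFst_l (V : Matrix β β ℂ) (M : Matrix (α × β) (α × β) ℂ) :
    trFst (((1 : Matrix α α ℂ) ⊗ₖ V) * M) = V * trFst M := by
  ext i j
  simp [trFst, Matrix.mul_apply, Fintype.sum_prod_type, Matrix.one_apply, Finset.mul_sum]
  rw [Finset.sum_comm]

lemma trFst_r (V : Matrix β β ℂ) (M : Matrix (α × β) (α × β) ℂ) :
    trFst (M * ((1 : Matrix α α ℂ) ⊗ₖ V)) = trFst M * V := by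
  ext i j
  simp [trFst, Matrix.mul_apply, Fintype.sum_prod_type, Matrix.one_apply, Finset.sum_mul]
  rw [Finset.sum_comm]

lemma trFst_c (W : Matrix α α ℂ) (M : Matrix (α × β) (α × β) ℂ) :
    trFst ((W ⊗ₖ (1 : Matrix β β ℂ)) * M) = trFst (M * (W ⊗ₖ (1 : Matrix β β ℂ))) := by
  ext i j
  simp [trFst, Matrix.mul_apply, Fintype.sum_prod_type, Matrix.one_apply]
  rw [Finset.sum_comm]
  simp [mul_comm]

lemma kron_split (V : Matrix α α ℂ) (W : Matrix β β ℂ) :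
    V ⊗ₖ W = (V ⊗ₖ (1 : Matrix β β ℂ)) * ((1 : Matrix α α ℂ) ⊗ₖ W) := by
  rw [← Matrix.mul_kronecker_mul]; simp

lemma kron_split' (V : Matrix α α ℂ) (W : Matrix β β ℂ) :
    V ⊗ₖ W = ((1 : Matrix α α ℂ) ⊗ₖ W) * (V ⊗ₖ (1 : Matrix β β ℂ)) := by
  rw [← Matrix.mul_kronecker_mul]; simp

lemma trSnd_conj (V : Matrix α α ℂ) (W : Matrix β β ℂ) (hW : Wᴴ * W = 1)
    (M : Matrix (α × β) (α × β) ℂ) :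
    trSnd ((V ⊗ₖ W) * M * (V ⊗ₖ W)ᴴ) = V * trSnd M * Vᴴ := by
  rw [Matrix.conjTranspose_kronecker, kron_split' Vᴴ, kron_split V, ← mul_assoc, trSnd_r,
    mul_assoc, mul_assoc, trSnd_l, trSnd_c, mul_assoc, mul_assoc, ← Matrix.mul_kronecker_mul, hW]
  simp [mul_assoc]

lemma trFst_conj (V : Matrix α α ℂ) (W : Matrix β β ℂ) (hV : Vᴴ * V = 1)
    (M : Matrix (α × β) (α × β) ℂ) :
    trFst ((V ⊗ₖ W) * M * (V ⊗ₖ W)ᴴ) = W * trFst M * Wᴴ := by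
  rw [Matrix.conjTranspose_kronecker, kron_split Vᴴ, kron_split' V, ← mul_assoc, trFst_r,
    mul_assoc, mul_assoc, trFst_l, trFst_c, mul_assoc, mul_assoc, ← Matrix.mul_kronecker_mul, hV]
  simp [mul_assoc]

lemma trFst_herm {M : Matrix (α × β) (α × β) ℂ} (h : M.IsHermitian) : (trFst M).IsHermitian := by
  ext i j
  simp [trFst, ← h.apply (_, i) (_, j)]

lemma trSnd_herm {M : Matrix (α × β) (α × β) ℂ} (h : M.IsHermitian) : (trSnd M).IsHermitian := by
  ext i j
  simp [trSnd, ← h.apply (i, _) (j, _)]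

lemma vn_sub {M : Matrix (α × β) (α × β) ℂ} (hM : IsDensity M) :
    vnEntropy M ≤ vnEntropy (trSnd M) + vnEntropy (trFst M) := by
  have h1 := trSnd_herm hM.1.isHermitian
  have h2 := trFst_herm hM.1.isHermitian
  obtain ⟨V, hV1, hV2, hV⟩ := spec h1
  obtain ⟨W, hW1, hW2, hW⟩ := spec h2
  have c1 : (Vᴴ ⊗ₖ Wᴴ)ᴴ * (Vᴴ ⊗ₖ Wᴴ) = 1 := by
    rw [Matrix.conjTranspose_kronecker, ← Matrix.mul_kronecker_mul]; simp [hV1, hW1]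
  set T := (Vᴴ ⊗ₖ Wᴴ) * M * (Vᴴ ⊗ₖ Wᴴ)ᴴ with hT
  have hTp : T.PosSemidef := hM.1.mul_mul_conjTranspose_same _
  have t1 : trSnd T = Matrix.diagonal (fun i => (h1.eigenvalues i : ℂ)) := by
    rw [hT, trSnd_conj _ _ (by simpa using hW1)]
    exact undiag hV2 hV
  have t2 : trFst T = Matrix.diagonal (fun i => (h2.eigenvalues i : ℂ)) := by
    rw [hT, trFst_conj _ _ (by simpa using hV1)]
    exact undiag hW2 hW
  have m1 : ∀ i, ∑ j, (T (i, j) (i, j)).re = h1.eigenvalues i := by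
    intro i
    have := congrArg Complex.re (congrFun (congrFun t1 i) i)
    simpa [trSnd] using this
  have m2 : ∀ j, ∑ i, (T (i, j) (i, j)).re = h2.eigenvalues j := by
    intro i
    have := congrArg Complex.re (congrFun (congrFun t2 i) i)
    simpa [trFst] using this
  have htr : T.trace = 1 := by
    rw [hT, Matrix.trace_mul_comm, ← mul_assoc, c1, one_mul, hM.2]
  rw [← vn_conj hM.1.isHermitian c1, ← hT, vn_eigs h1, vn_eigs h2]
  refine (vn_pinch hTp).trans ?_
  have := classical_sub (fun i j => (T (i, j) (i, j)).re)
    (fun i j => (Complex.le_def.1 (hTp.diag_nonneg (i := (i, j)))).1) (by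
      have := congrArg Complex.re htr
      simpa [Matrix.trace, Fintype.sum_prod_type] using this)
  simp only [m1, m2] at this
  rwa [Fintype.sum_prod_type]

lemma vn_araki {M : Matrix (α × β) (α × β) ℂ} (hM : IsDensity M) :
    vnEntropy (trSnd M) ≤ vnEntropy (trFst M) + vnEntropy M := by
  obtain ⟨K, hK⟩ : ∃ K : Matrix (α × β) (α × β) ℂ, M = K * Kᴴ := by
    obtain ⟨B, hB⟩ := factor hM.1
    exact ⟨Bᴴ, by simpa using hB⟩
  let N : Matrix α (β × (α × β)) ℂ := Matrix.of fun a x => K (a, x.1) x.2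
  have e1 : trSnd M = N * Nᴴ := by
    ext i j
    simp [hK, trSnd, N, Matrix.mul_apply, Fintype.sum_prod_type]
  have e2 : trFst (Nᴴ * N) = Kᴴ * K := by
    ext i j
    simp [trFst, N, Matrix.mul_apply, Fintype.sum_prod_type]
    rw [Finset.sum_comm]
  have e3 : trSnd (Nᴴ * N) = (trFst M)ᵀ := by
    ext i j
    simp only [hK, trFst, trSnd, N, Matrix.mul_apply, Matrix.of_apply, Matrix.transpose_apply,
      Matrix.conjTranspose_apply]
    rw [Finset.sum_comm]
    simp [mul_comm]
  have hd : IsDensity (Nᴴ * N) := by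
    refine ⟨Matrix.posSemidef_conjTranspose_mul_self N, ?_⟩
    rw [Matrix.trace_mul_comm, ← e1, ← hM.2]
    simp [Matrix.trace, trSnd, Fintype.sum_prod_type]
  have := vn_sub hd
  rwa [e2, e3, vn_transpose (trFst_herm hM.1.isHermitian), ← vn_comm, ← vn_comm, ← e1, ← hK] at this

lemma trFst_density {M : Matrix (α × β) (α × β) ℂ} (hM : IsDensity M) : IsDensity (trFst M) := by
  obtain ⟨B, hB⟩ := factor hM.1
  let N : Matrix (α × (α × β)) β ℂ := Matrix.of fun x b => B x.2 (x.1, b)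
  have e : trFst M = Nᴴ * N := by
    ext i j
    simp [hB, trFst, N, Matrix.mul_apply, Fintype.sum_prod_type]
  refine ⟨e ▸ Matrix.posSemidef_conjTranspose_mul_self N, ?_⟩
  rw [← hM.2]
  simp only [Matrix.trace, trFst, Fintype.sum_prod_type, Matrix.diag, Matrix.of_apply]
  rw [Finset.sum_comm]

end Sub

lemma ext_unitary {m dA dB : ℕ} (U : Matrix (Fin dA × Fin dB) (Fin dA × Fin dB) ℂ)
    (hU : Uᴴ * U = 1) :
    (extUnitary U : Matrix ((Fin m × Fin dA) × Fin dB) ((Fin m × Fin dA) × Fin dB) ℂ)ᴴ *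
      extUnitary U = 1 := by
  have e : (extUnitary U : Matrix ((Fin m × Fin dA) × Fin dB) ((Fin m × Fin dA) × Fin dB) ℂ) =
      ((1 : Matrix (Fin m) (Fin m) ℂ) ⊗ₖ U).submatrix (Equiv.prodAssoc _ _ _)
        (Equiv.prodAssoc _ _ _) := by
    ext p q
    simp [extUnitary, Matrix.one_apply]
  rw [e, Matrix.conjTranspose_submatrix, Matrix.submatrix_mul_equiv, Matrix.conjTranspose_kronecker,
    ← Matrix.mul_kronecker_mul, hU]
  simp

lemma ext_tr {m dA dB : ℕ} (U : Matrix (Fin dA × Fin dB) (Fin dA × Fin dB) ℂ)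
    (σ : Matrix (Fin dB) (Fin dB) ℂ) (ρ : Matrix (Fin m × Fin dA) (Fin m × Fin dA) ℂ) :
    trFst ((extUnitary U : Matrix ((Fin m × Fin dA) × Fin dB)
        ((Fin m × Fin dA) × Fin dB) ℂ) * (ρ ⊗ₖ σ) * (extUnitary U)ᴴ) =
      trFst (U * (trFst ρ ⊗ₖ σ) * Uᴴ) := by
  have key : ∀ (r : Fin m) (a : Fin dA) (b b' : Fin dB), ((extUnitary U : Matrix ((Fin m × Fin dA) × Fin dB)
        ((Fin m × Fin dA) × Fin dB) ℂ) * (ρ ⊗ₖ σ) * (extUnitary U : Matrix ((Fin m × Fin dA) × Fin dB)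
        ((Fin m × Fin dA) × Fin dB) ℂ)ᴴ) ((r, a), b) ((r, a), b') =
      (U * ((ρ.submatrix (Prod.mk r) (Prod.mk r)) ⊗ₖ σ) * Uᴴ) (a, b) (a, b') := by
    intro r a b b'
    simp only [Matrix.mul_apply, extUnitary, Fintype.sum_prod_type, Matrix.of_apply,
      Matrix.conjTranspose_apply, Matrix.kroneckerMap_apply, Matrix.submatrix_apply]
    rw [Finset.sum_eq_single r]
    · refine Finset.sum_congr rfl fun c _ => Finset.sum_congr rfl fun d _ => ?_
      rw [Finset.sum_eq_single r]
      · simp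
      · intro s _ hs; simp [hs.symm]
      · simp
    · intro s _ hs; simp [hs.symm]
    · simp
  have e : trFst ρ = ∑ r, ρ.submatrix (Prod.mk r) (Prod.mk r) := by
    ext i j; simp [trFst, Matrix.sum_apply]
  have e2 : trFst ρ ⊗ₖ σ = ∑ r, (ρ.submatrix (Prod.mk r) (Prod.mk r)) ⊗ₖ σ := by
    rw [e]; ext i j; simp [Matrix.sum_apply, Finset.sum_mul]
  ext b b'
  rw [e2, Finset.mul_sum, Finset.sum_mul]
  simp only [trFst, Matrix.of_apply, Fintype.sum_prod_type, key, Matrix.sum_apply]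
  rw [Finset.sum_comm]

/-- Corollary 3 (quantum case): the entropy of a catalyst bounds half the entropy variance of
the catalytically implemented map, even on extended inputs. -/
theorem stmt9 {dA dB : ℕ} (U : Matrix (Fin dA × Fin dB) (Fin dA × Fin dB) ℂ)
    (hU : IsUnitary U) (σ : Matrix (Fin dB) (Fin dB) ℂ) (hσ : IsDensity σ)
    (hcanon : ∀ ρ : Matrix (Fin dA) (Fin dA) ℂ, IsDensity ρ →
      trFst (U * (ρ ⊗ₖ σ) * Uᴴ) = σ)
    (m : ℕ) (hm : 0 < m)
    (ρ : Matrix (Fin m × Fin dA) (Fin m × Fin dA) ℂ) (hρ : IsDensity ρ)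
    (ω : Matrix (Fin m × Fin dA) (Fin m × Fin dA) ℂ)
    (hω : ω = trSnd ((extUnitary U : Matrix ((Fin m × Fin dA) × Fin dB)
        ((Fin m × Fin dA) × Fin dB) ℂ) * (ρ ⊗ₖ σ) * (extUnitary U)ᴴ)) :
    |vnEntropy ω - vnEntropy ρ| ≤ 2 * vnEntropy σ := by

  set T := (extUnitary U : Matrix ((Fin m × Fin dA) × Fin dB)
        ((Fin m × Fin dA) × Fin dB) ℂ) * (ρ ⊗ₖ σ) * (extUnitary U)ᴴ with hT
  have hu := ext_unitary (m := m) U hU.2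
  have hk : (ρ ⊗ₖ σ).PosSemidef := hρ.1.kronecker hσ.1
  have hd : IsDensity T := by
    refine ⟨hk.mul_mul_conjTranspose_same _, ?_⟩
    rw [hT, Matrix.trace_mul_comm, ← mul_assoc, hu, one_mul, Matrix.trace_kronecker, hρ.2, hσ.2,
      one_mul]
  have hf : trFst T = σ := by
    rw [hT, ext_tr]
    exact hcanon _ (trFst_density hρ)
  have hS : vnEntropy T = vnEntropy ρ + vnEntropy σ := by
    rw [hT, vn_conj hk.isHermitian hu, vn_kron hρ hσ]
  have h1 := vn_sub hd
  have h2 := vn_araki hd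
  rw [← hω, hf, hS] at h1 h2
  rw [abs_le]
  constructor <;> linarith
end

section
/- Let α ∈ (0,1) ∪ (1,∞). Let (U, σ) be a catalysis in canonical form: U a unitary on ℂ^{d_A} ⊗ ℂ^{d_B} and σ a density matrix on ℂ^{d_B} with Tr_A(U(ρ ⊗ σ)U†) = σ for every density matrix ρ on ℂ^{d_A}. Write the spectral decomposition σ = ∑_{i=1}^n λ_i Π_i with distinct eigenvalues λ_i and multiplicities r_i = Tr Π_i. Let r be any positive integer, let Û denote the unitary on ℂ^r ⊗ ℂ^{d_A} ⊗ ℂ^{d_B} acting as the identity on the first factor and as U on the last two factors, and for a density matrix ρ on ℂ^r ⊗ ℂ^{d_A} set ω = Tr_B(Û(ρ ⊗ σ)Û†). Then the Rényi entropy production is bounded by the catalytic Rényi entropy of σ: S_α(ω) − S_α(ρ) ≤ (1/(1−α)) log₂ ∑_i λ_i^α r_i^{2−α}. -/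
open scoped Matrix Kronecker BigOperators Classical ComplexOrder

theorem spec_data {n : Type*} [Fintype n] [DecidableEq n] {A : Matrix n n ℂ}
    (h : A.IsHermitian) : ∃ V : Matrix n n ℂ, V * Vᴴ = 1 ∧ Vᴴ * V = 1 ∧
      A = V * Matrix.diagonal (fun i => (h.eigenvalues i : ℂ)) * Vᴴ := by
  refine ⟨h.eigenvectorUnitary, ?_, ?_, ?_⟩
  · exact Unitary.coe_mul_star_self h.eigenvectorUnitary
  · exact Unitary.coe_star_mul_self h.eigenvectorUnitary
  · exact h.spectral_theorem

theorem gram_row {N J : Type*} [Fintype N] [Fintype J] [DecidableEq N]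
    (G : Matrix N J ℂ) (q : N → ℝ)
    (hG : G * Gᴴ = Matrix.diagonal (fun i => (q i : ℂ))) (b : N) :
    ∑ j, Complex.normSq (G b j) = q b := by
  have h := congrFun (congrFun hG b) b
  simp only [Matrix.mul_apply, Matrix.conjTranspose_apply, Matrix.diagonal_apply_eq] at h
  have h2 : ((∑ j, Complex.normSq (G b j) : ℝ) : ℂ) = (q b : ℂ) := by
    rw [← h]; push_cast
    exact Finset.sum_congr rfl fun j _ => (Complex.mul_conj _).symm
  exact_mod_cast h2

theorem gram_col {N J : Type*} [Fintype N] [Fintype J] [DecidableEq N]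
    (G : Matrix N J ℂ) (q : N → ℝ)
    (hG : G * Gᴴ = Matrix.diagonal (fun i => (q i : ℂ))) (j : J) :
    ∑ b, Complex.normSq (G b j) / q b ≤ 1 := by
  set Q : Matrix N N ℂ := Matrix.diagonal (fun i => ((q i)⁻¹ : ℂ)) with hQ
  set M := Gᴴ * Q * G with hM
  have hQh : Qᴴ = Q := by
    rw [hQ, Matrix.diagonal_conjTranspose]; congr 1; ext i
    simp
  have hMh : Mᴴ = M := by
    rw [hM]; simp [Matrix.conjTranspose_mul, hQh, Matrix.mul_assoc]
  have hQQ : Q * (G * Gᴴ) * Q = Q := by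
    rw [hG, hQ, Matrix.diagonal_mul_diagonal, Matrix.diagonal_mul_diagonal]
    congr 1; ext i
    by_cases h : (q i : ℂ) = 0
    · simp [h]
    · field_simp
  have hMM : M * Mᴴ = M := by
    rw [hMh]
    calc M * M = Gᴴ * (Q * (G * Gᴴ) * Q) * G := by simp only [hM, Matrix.mul_assoc]
      _ = M := by rw [hQQ]
  have hjj : M j j = ((∑ b, Complex.normSq (G b j) / q b : ℝ) : ℂ) := by
    rw [hM, hQ, Matrix.mul_apply]
    push_cast
    refine Finset.sum_congr rfl fun b _ => ?_
    rw [Matrix.mul_diagonal, Matrix.conjTranspose_apply, Complex.normSq_eq_conj_mul_self]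
    simp only [RCLike.star_def]
    ring
  set s := ∑ b, Complex.normSq (G b j) / q b with hs
  have h1 : ∑ k, Complex.normSq (M j k) = s := by
    have h := congrFun (congrFun hMM j) j
    rw [Matrix.mul_apply, hjj] at h
    have h2 : ((∑ k, Complex.normSq (M j k) : ℝ) : ℂ) = (s : ℂ) := by
      rw [← h]; push_cast
      exact Finset.sum_congr rfl fun j _ => (Complex.mul_conj _).symm
    exact_mod_cast h2
  have h2 : Complex.normSq (M j j) ≤ s := by
    rw [← h1]
    exact Finset.single_le_sum (f := fun k => Complex.normSq (M j k))
      (fun k _ => Complex.normSq_nonneg _) (Finset.mem_univ j)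
  rw [hjj, Complex.normSq_ofReal] at h2
  by_contra h
  push Not at h
  nlinarith

theorem rank_one {N J : Type*} [Fintype N] [Fintype J] [DecidableEq N]
    (α : ℝ) (hα0 : 0 < α) (W : Matrix N J ℂ) (A : Matrix N N ℂ) (h : A.IsHermitian)
    (hA : A = W * Wᴴ) :
    (α ≤ 1 → ∑ b, h.eigenvalues b ^ α ≤ ∑ j, (∑ x, Complex.normSq (W x j)) ^ α) ∧
    (1 ≤ α → ∑ j, (∑ x, Complex.normSq (W x j)) ^ α ≤ ∑ b, h.eigenvalues b ^ α) := by
  obtain ⟨V, hV1, hV2, hV⟩ := spec_data h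
  set q := h.eigenvalues with hq
  set G := Vᴴ * W with hGdef
  have hG : G * Gᴴ = Matrix.diagonal (fun i => (q i : ℂ)) := by
    calc G * Gᴴ = Vᴴ * (W * Wᴴ) * V := by
          simp [hGdef, Matrix.conjTranspose_mul, Matrix.mul_assoc]
      _ = (Vᴴ * V) * Matrix.diagonal (fun i => (q i : ℂ)) * (Vᴴ * V) := by
          rw [← hA, hV]; simp only [Matrix.mul_assoc]
      _ = _ := by rw [hV2]; simp
  have hrow := gram_row G q hG
  have hcol := gram_col G q hG
  have hq0 : ∀ b, 0 ≤ q b := fun b => by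
    rw [← hrow b]; exact Finset.sum_nonneg fun _ _ => Complex.normSq_nonneg _
  have hz : ∀ b j, Complex.normSq (G b j) / q b * q b = Complex.normSq (G b j) := by
    intro b j
    by_cases hb : q b = 0
    · have := hrow b
      rw [hb, Finset.sum_eq_zero_iff_of_nonneg (fun _ _ => Complex.normSq_nonneg _)] at this
      rw [this j (Finset.mem_univ _)]; simp
    · field_simp
  have hnorm : ∀ j, ∑ x, Complex.normSq (W x j) = ∑ b, Complex.normSq (G b j) / q b * q b := by
    intro j
    have h1 : Gᴴ * G = Wᴴ * W := by
      calc Gᴴ * G = Wᴴ * (V * Vᴴ) * W := by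
            simp [hGdef, Matrix.conjTranspose_mul, Matrix.mul_assoc]
        _ = _ := by rw [hV1]; simp
    have h2 := congrFun (congrFun h1 j) j
    simp only [Matrix.mul_apply, Matrix.conjTranspose_apply, RCLike.star_def,
      ← Complex.normSq_eq_conj_mul_self] at h2
    simp only [hz]
    exact_mod_cast h2.symm
  have hD0 : ∀ b j, 0 ≤ Complex.normSq (G b j) / q b := fun b j =>
    div_nonneg (Complex.normSq_nonneg _) (hq0 b)
  have hsum : ∑ j, ∑ b, Complex.normSq (G b j) / q b * q b ^ α = ∑ b, q b ^ α := by
    rw [Finset.sum_comm]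
    refine Finset.sum_congr rfl fun b _ => ?_
    rw [← Finset.sum_mul, ← Finset.sum_div, hrow]
    by_cases hb : q b = 0
    · simp [hb, Real.zero_rpow hα0.ne']
    · field_simp
  constructor
  · intro hα
    rw [← hsum]
    refine Finset.sum_le_sum fun j _ => ?_
    rw [hnorm j]
    have := (Real.concaveOn_rpow hα0.le hα).map_add_sum_le (t := Finset.univ)
      (w := fun b => Complex.normSq (G b j) / q b) (p := q) (q := 0)
      (v := 1 - ∑ b, Complex.normSq (G b j) / q b)
      (fun b _ => hD0 b j) (by ring) (fun b _ => hq0 b) (by linarith [hcol j]) (by simp)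
    simpa [Real.zero_rpow hα0.ne'] using this
  · intro hα
    rw [← hsum]
    refine Finset.sum_le_sum fun j _ => ?_
    rw [hnorm j]
    have := (convexOn_rpow hα).map_add_sum_le (t := Finset.univ)
      (w := fun b => Complex.normSq (G b j) / q b) (p := q) (q := 0)
      (v := 1 - ∑ b, Complex.normSq (G b j) / q b)
      (fun b _ => hD0 b j) (by ring) (fun b _ => hq0 b) (by linarith [hcol j]) (by simp)
    simpa [Real.zero_rpow hα0.ne'] using this

theorem power_mean {J : Type*} (s : Finset J) (hs : s.Nonempty) (α : ℝ) (hα0 : 0 < α)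
    (c : J → ℝ) (hc : ∀ j ∈ s, 0 ≤ c j) (h1 : ∑ j ∈ s, c j = 1) :
    (α ≤ 1 → ∑ j ∈ s, c j ^ α ≤ (s.card : ℝ) ^ (1 - α)) ∧
    (1 ≤ α → (s.card : ℝ) ^ (1 - α) ≤ ∑ j ∈ s, c j ^ α) := by
  have hR : (0 : ℝ) < s.card := by exact_mod_cast hs.card_pos
  have key : (s.card : ℝ) ^ (1 - α) = s.card * ((s.card : ℝ)⁻¹) ^ α := by
    rw [Real.rpow_sub hR, Real.rpow_one, Real.inv_rpow hR.le]; rfl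
  have hw : ∑ j ∈ s, (s.card : ℝ)⁻¹ = 1 := by simp [hR.ne']
  constructor
  · intro hα
    have := (Real.concaveOn_rpow hα0.le hα).le_map_sum (t := s)
      (w := fun _ => (s.card : ℝ)⁻¹) (p := c) (fun _ _ => by positivity) hw hc
    simp only [smul_eq_mul, ← Finset.mul_sum, h1, mul_one] at this
    rw [key]
    rwa [inv_mul_le_iff₀ hR] at this
  · intro hα
    have := (convexOn_rpow hα).map_sum_le (t := s)
      (w := fun _ => (s.card : ℝ)⁻¹) (p := c) (fun _ _ => by positivity) hw hc
    simp only [smul_eq_mul, ← Finset.mul_sum, h1, mul_one] at this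
    rw [key]
    rwa [le_inv_mul_iff₀ hR] at this
theorem core {N B : Type*} [Fintype N] [Fintype B] [DecidableEq N] [DecidableEq B]
    (α : ℝ) (hα0 : 0 < α) (Z : Matrix (N × B) (N × B) ℂ) (hZ : Zᴴ * Z = 1)
    (p : N → ℝ) (s : B → ℝ) (hp : ∀ a, 0 ≤ p a) (hs : ∀ b, 0 ≤ s b)
    (hblk : ∀ x c a b, s c ≠ s b → Z (x, c) (a, b) = 0)
    (A : Matrix N N ℂ) (h : A.IsHermitian)
    (hA : A = trSnd (Z * Matrix.diagonal (fun ab : N × B => ((p ab.1 * s ab.2 : ℝ) : ℂ)) * Zᴴ)) :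
    (α ≤ 1 → ∑ b, h.eigenvalues b ^ α ≤ (∑ a, p a ^ α) *
      ∑ b, s b ^ α * ((Finset.univ.filter fun c => s c = s b).card : ℝ) ^ (1 - α)) ∧
    (1 ≤ α → (∑ a, p a ^ α) *
      ∑ b, s b ^ α * ((Finset.univ.filter fun c => s c = s b).card : ℝ) ^ (1 - α) ≤
        ∑ b, h.eigenvalues b ^ α) := by
  let W : Matrix N ((N × B) × B) ℂ := Matrix.of fun x j =>
    (Real.sqrt (p j.1.1 * s j.1.2) : ℂ) * Z (x, j.2) j.1
  have hAW : A = W * Wᴴ := by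
    rw [hA]
    ext x y
    simp only [trSnd, Matrix.of_apply, Matrix.mul_apply,
      Matrix.conjTranspose_apply, W]
    rw [Fintype.sum_prod_type, Finset.sum_comm]
    refine Finset.sum_congr rfl fun ab _ => Finset.sum_congr rfl fun c _ => ?_
    have : ((p ab.1 * s ab.2 : ℝ) : ℂ) =
        (Real.sqrt (p ab.1 * s ab.2) : ℂ) * (Real.sqrt (p ab.1 * s ab.2) : ℂ) := by
      rw [← Complex.ofReal_mul, Real.mul_self_sqrt (mul_nonneg (hp _) (hs _))]
    rw [← Matrix.mul_apply, Matrix.mul_diagonal, this]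
    simp only [star_mul', RCLike.star_def, Complex.conj_ofReal]
    ring
  let c : N → B → B → ℝ := fun a b k => ∑ x, Complex.normSq (Z (x, k) (a, b))
  have hc0 : ∀ a b k, 0 ≤ c a b k := fun a b k =>
    Finset.sum_nonneg fun _ _ => Complex.normSq_nonneg _
  have hcz : ∀ a b k, s k ≠ s b → c a b k = 0 := fun a b k hk =>
    Finset.sum_eq_zero fun x _ => by rw [hblk x k a b hk]; simp
  have hc1 : ∀ a b, ∑ k ∈ Finset.univ.filter (fun k => s k = s b), c a b k = 1 := by
    intro a b
    rw [Finset.sum_filter_of_ne (fun k _ hk => by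
      by_contra hh; exact hk (hcz a b k hh))]
    have h1 := congrFun (congrFun hZ (a, b)) (a, b)
    simp only [Matrix.mul_apply, Matrix.conjTranspose_apply, RCLike.star_def,
      ← Complex.normSq_eq_conj_mul_self, Matrix.one_apply_eq] at h1
    rw [Fintype.sum_prod_type, Finset.sum_comm] at h1
    exact_mod_cast h1
  have hW : ∑ j, (∑ x, Complex.normSq (W x j)) ^ α = ∑ b, s b ^ α * ∑ a, p a ^ α *
      ∑ k ∈ Finset.univ.filter (fun k => s k = s b), c a b k ^ α := by
    rw [Fintype.sum_prod_type, Fintype.sum_prod_type, Finset.sum_comm]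
    refine Finset.sum_congr rfl fun b _ => ?_
    rw [Finset.mul_sum]
    refine Finset.sum_congr rfl fun a _ => ?_
    rw [Finset.sum_filter_of_ne (fun k _ hk => by
      by_contra hh; exact hk (by rw [hcz a b k hh, Real.zero_rpow hα0.ne'])),
      Finset.mul_sum, Finset.mul_sum]
    refine Finset.sum_congr rfl fun k _ => ?_
    have : ∑ x, Complex.normSq (W x ((a, b), k)) = s b * (p a * c a b k) := by
      simp only [W, c, Matrix.of_apply, Complex.normSq_mul, Complex.normSq_ofReal]
      rw [← Finset.mul_sum, Real.mul_self_sqrt (mul_nonneg (hp _) (hs _))]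
      ring
    rw [this, Real.mul_rpow (hs b) (mul_nonneg (hp a) (hc0 a b k)),
      Real.mul_rpow (hp a) (hc0 a b k)]
  have hne : ∀ b, (Finset.univ.filter (fun k => s k = s b)).Nonempty := fun b =>
    ⟨b, by simp⟩
  have hRHS : (∑ a, p a ^ α) *
      ∑ b, s b ^ α * ((Finset.univ.filter fun c => s c = s b).card : ℝ) ^ (1 - α) =
      ∑ b, s b ^ α * ∑ a, p a ^ α *
        ((Finset.univ.filter fun c => s c = s b).card : ℝ) ^ (1 - α) := by
    rw [Finset.mul_sum]
    refine Finset.sum_congr rfl fun b _ => ?_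
    rw [← Finset.sum_mul]; ring
  obtain ⟨k1, k2⟩ := rank_one α hα0 W A h hAW
  rw [hW] at k1 k2
  rw [hRHS]
  constructor
  · intro hα
    refine (k1 hα).trans ?_
    refine Finset.sum_le_sum fun b _ => mul_le_mul_of_nonneg_left
      (Finset.sum_le_sum fun a _ => mul_le_mul_of_nonneg_left ?_
        (Real.rpow_nonneg (hp a) _)) (Real.rpow_nonneg (hs b) _)
    exact (power_mean _ (hne b) α hα0 (c a b) (fun k _ => hc0 a b k) (hc1 a b)).1 hα
  · intro hα
    refine le_trans ?_ (k2 hα)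
    refine Finset.sum_le_sum fun b _ => mul_le_mul_of_nonneg_left
      (Finset.sum_le_sum fun a _ => mul_le_mul_of_nonneg_left ?_
        (Real.rpow_nonneg (hp a) _)) (Real.rpow_nonneg (hs b) _)
    exact (power_mean _ (hne b) α hα0 (c a b) (fun k _ => hc0 a b k) (hc1 a b)).2 hα

theorem count_lem {B : Type*} [Fintype B] [DecidableEq B] {n : ℕ}
    (F : Matrix B B ℂ) (hF1 : F * Fᴴ = 1) (hF2 : Fᴴ * F = 1) (s : B → ℝ)
    (σ : Matrix B B ℂ) (hσ : σ = F * Matrix.diagonal (fun i => (s i : ℂ)) * Fᴴ)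
    (lam : Fin n → ℝ) (P : Fin n → Matrix B B ℂ) (r : Fin n → ℕ)
    (hdec : σ = ∑ i, (lam i : ℂ) • P i)
    (hdist : Function.Injective lam)
    (hproj : ∀ i, (P i).IsHermitian ∧ P i * P i = P i)
    (horth : ∀ i j, i ≠ j → P i * P j = 0)
    (hres : ∑ i, P i = 1)
    (htr : ∀ i, (P i).trace = (r i : ℂ)) :
    ∃ g : B → Fin n, (∀ b, s b = lam (g b)) ∧
      ∀ i, (Finset.univ.filter fun b => g b = i).card = r i := by
  let P' : Fin n → Matrix B B ℂ := fun i => Fᴴ * P i * F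
  have hPs : ∀ i, P i * σ = (lam i : ℂ) • P i := by
    intro i
    rw [hdec, Finset.mul_sum, Finset.sum_eq_single i]
    · rw [Matrix.mul_smul, (hproj i).2]
    · intro j _ hj
      rw [Matrix.mul_smul, horth i j hj.symm, smul_zero]
    · simp
  have hP's : ∀ i, P' i * Matrix.diagonal (fun i => (s i : ℂ)) = (lam i : ℂ) • P' i := by
    intro i
    have : Fᴴ * (P i * σ) * F = P' i * Matrix.diagonal (fun i => (s i : ℂ)) * (Fᴴ * F) := by
      rw [hσ]; simp only [P', Matrix.mul_assoc]
    rw [hF2, Matrix.mul_one] at this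
    rw [← this, hPs, Matrix.mul_smul, Matrix.smul_mul]
  have hz : ∀ i b, s b ≠ lam i → P' i b b = 0 := by
    intro i b hb
    have := congrFun (congrFun (hP's i) b) b
    rw [Matrix.mul_diagonal, Matrix.smul_apply, smul_eq_mul] at this
    have h2 : ((s b : ℂ) - lam i) * P' i b b = 0 := by linear_combination this
    rcases mul_eq_zero.1 h2 with h3 | h3
    · exact absurd (by exact_mod_cast sub_eq_zero.1 h3) hb
    · exact h3
  have hone : ∀ b, ∑ i, P' i b b = 1 := by
    intro b
    have : ∑ i, P' i = 1 := by
      simp only [P']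
      rw [← Finset.sum_mul, ← Finset.mul_sum, hres, Matrix.mul_one, hF2]
    have := congrFun (congrFun this b) b
    rwa [Matrix.sum_apply, Matrix.one_apply_eq] at this
  have hex : ∀ b, ∃ i, s b = lam i := by
    intro b
    by_contra hb
    push Not at hb
    have := hone b
    rw [Finset.sum_eq_zero (fun i _ => hz i b (hb i))] at this
    exact zero_ne_one this
  choose g hg using hex
  refine ⟨g, hg, fun i => ?_⟩
  have hd : ∀ b, P' i b b = if g b = i then 1 else 0 := by
    intro b
    split_ifs with hb
    · rw [← hone b, Finset.sum_eq_single i]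
      · intro j _ hj
        exact hz j b (fun h => hj (hdist (by rw [← h, hg b, hb])))
      · simp
    · exact hz i b (fun h => hb (hdist (by rw [← h, hg b])))
  have ht : (P' i).trace = (r i : ℂ) := by
    simp only [P']
    rw [Matrix.trace_mul_comm, ← Matrix.mul_assoc, hF1, Matrix.one_mul, htr]
  rw [Matrix.trace] at ht
  simp only [Matrix.diag_apply, hd, Finset.sum_boole] at ht
  exact_mod_cast ht

theorem commute_lem {dA dB : ℕ} (U : Matrix (Fin dA × Fin dB) (Fin dA × Fin dB) ℂ)
    (hU : IsUnitary U) (σ : Matrix (Fin dB) (Fin dB) ℂ) (hσ : σ.IsHermitian) (hdA : 0 < dA)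
    (hcanon : ∀ ρ : Matrix (Fin dA) (Fin dA) ℂ, IsDensity ρ →
      trFst (U * (ρ ⊗ₖ σ) * Uᴴ) = σ) :
    U * ((1 : Matrix (Fin dA) (Fin dA) ℂ) ⊗ₖ σ) = ((1 : Matrix (Fin dA) (Fin dA) ℂ) ⊗ₖ σ) * U := by
  have hd : (dA : ℂ) ≠ 0 := by exact_mod_cast hdA.ne'
  set S := ((1 : Matrix (Fin dA) (Fin dA) ℂ) ⊗ₖ σ) with hS
  have hSh : Sᴴ = S := by
    rw [hS, Matrix.conjTranspose_kronecker, Matrix.conjTranspose_one, hσ.eq]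
  have hmm : IsDensity ((dA : ℂ)⁻¹ • (1 : Matrix (Fin dA) (Fin dA) ℂ)) := by
    constructor
    · refine Matrix.PosSemidef.one.smul ?_
      simp
    · simp [Matrix.trace_smul, hd]
  have h1 : trFst (U * S * Uᴴ) = (dA : ℂ) • σ := by
    have h := hcanon _ hmm
    rw [Matrix.smul_kronecker, ← hS, Matrix.mul_smul, Matrix.smul_mul] at h
    have h2 : trFst ((dA : ℂ)⁻¹ • (U * S * Uᴴ)) = (dA : ℂ)⁻¹ • trFst (U * S * Uᴴ) := by
      ext k l
      simp [trFst, Finset.mul_sum]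
    rw [h2] at h
    conv_rhs => rw [← h]
    rw [smul_smul, mul_inv_cancel₀ hd, one_smul]
  have h3 : ∀ M : Matrix (Fin dA × Fin dB) (Fin dA × Fin dB) ℂ,
      (M * S).trace = (trFst M * σ).trace := by
    intro M
    simp only [Matrix.trace, Matrix.diag_apply, Matrix.mul_apply, hS, Fintype.sum_prod_type,
      Matrix.kroneckerMap_apply, Matrix.one_apply, trFst, Matrix.of_apply, Finset.sum_mul]
    simp only [ite_mul, one_mul, zero_mul, mul_ite, mul_zero]
    rw [Finset.sum_comm]
    refine Finset.sum_congr rfl fun k _ => ?_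
    conv_rhs => rw [Finset.sum_comm]
    refine Finset.sum_congr rfl fun i _ => ?_
    rw [Finset.sum_comm]
    refine Finset.sum_congr rfl fun l _ => ?_
    simp
  have h4 : (U * S * Uᴴ * S).trace = dA * (σ * σ).trace := by
    rw [h3, h1, Matrix.smul_mul, Matrix.trace_smul, smul_eq_mul]
  have h5 : (S * S).trace = dA * (σ * σ).trace := by
    rw [hS, ← Matrix.mul_kronecker_mul, Matrix.trace_kronecker, Matrix.one_mul, Matrix.trace_one,
      Fintype.card_fin]
  have h6 : ((U * S - S * U) * (U * S - S * U)ᴴ).trace = 0 := by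
    have e : (U * S - S * U) * (U * S - S * U)ᴴ =
        U * (S * S) * Uᴴ - U * S * Uᴴ * S - S * (U * S * Uᴴ) + S * (U * Uᴴ) * S := by
      simp only [Matrix.conjTranspose_sub, Matrix.conjTranspose_mul, hSh]
      noncomm_ring
    rw [e, Matrix.trace_add, Matrix.trace_sub, Matrix.trace_sub, Matrix.trace_mul_comm S (_ * _),
      h4, hU.1, Matrix.mul_one, h5, Matrix.trace_mul_comm, ← Matrix.mul_assoc, hU.2,
      Matrix.one_mul, h5]
    ring
  rw [Matrix.trace_mul_conjTranspose_self_eq_zero_iff] at h6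
  exact sub_eq_zero.1 h6
theorem ext_unit {m dA dB : ℕ} (U : Matrix (Fin dA × Fin dB) (Fin dA × Fin dB) ℂ)
    (hU : IsUnitary U) :
    (extUnitary U : Matrix ((Fin m × Fin dA) × Fin dB) ((Fin m × Fin dA) × Fin dB) ℂ)ᴴ *
      extUnitary U = 1 := by
  ext ⟨⟨i, a⟩, b⟩ ⟨⟨j, a'⟩, b'⟩
  have h := congrFun (congrFun hU.2 (a, b)) (a', b')
  simp only [Matrix.mul_apply, Matrix.conjTranspose_apply, Fintype.sum_prod_type] at h
  simp only [Matrix.mul_apply, Matrix.conjTranspose_apply, Fintype.sum_prod_type, extUnitary,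
    Matrix.of_apply]
  rw [Finset.sum_eq_single i]
  · simp only [if_true]
    by_cases hij : i = j
    · subst hij
      simp only [if_true, h, Matrix.one_apply, Prod.mk.injEq, true_and]
    · simp [hij]
  · intro k _ hk
    simp [hk]
  · simp

theorem ext_comm {m dA dB : ℕ} (U : Matrix (Fin dA × Fin dB) (Fin dA × Fin dB) ℂ)
    (σ : Matrix (Fin dB) (Fin dB) ℂ)
    (h : U * ((1 : Matrix (Fin dA) (Fin dA) ℂ) ⊗ₖ σ) =
      ((1 : Matrix (Fin dA) (Fin dA) ℂ) ⊗ₖ σ) * U) :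
    (extUnitary U : Matrix ((Fin m × Fin dA) × Fin dB) ((Fin m × Fin dA) × Fin dB) ℂ) *
      ((1 : Matrix (Fin m × Fin dA) (Fin m × Fin dA) ℂ) ⊗ₖ σ) =
    ((1 : Matrix (Fin m × Fin dA) (Fin m × Fin dA) ℂ) ⊗ₖ σ) * extUnitary U := by
  ext ⟨⟨i, a⟩, b⟩ ⟨⟨j, a'⟩, b'⟩
  have h := congrFun (congrFun h (a, b)) (a', b')
  simp only [Matrix.mul_apply, Fintype.sum_prod_type, Matrix.kroneckerMap_apply,
    Matrix.one_apply, ite_mul, one_mul, zero_mul, mul_ite, mul_zero] at h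
  simp only [Matrix.mul_apply, Fintype.sum_prod_type, Matrix.kroneckerMap_apply,
    Matrix.one_apply, extUnitary, Matrix.of_apply, Prod.mk.injEq]
  rw [Finset.sum_eq_single j, Finset.sum_eq_single i]
  · by_cases hij : i = j
    · subst hij
      simpa using h
    · simp [hij]
  · intro k _ hk
    simp [hk.symm]
  · simp
  · intro k _ hk
    simp [hk]
  · simp

theorem trSnd_conj_s13 {N B : Type*} [Fintype N] [Fintype B] [DecidableEq N] [DecidableEq B]
    (F : Matrix B B ℂ) (hF1 : F * Fᴴ = 1) (M : Matrix (N × B) (N × B) ℂ) :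
    trSnd (((1 : Matrix N N ℂ) ⊗ₖ Fᴴ) * M * ((1 : Matrix N N ℂ) ⊗ₖ F)) = trSnd M := by
  ext x y
  let M' : Matrix B B ℂ := Matrix.of fun k l => M (x, k) (y, l)
  have h1 : ∀ k, (((1 : Matrix N N ℂ) ⊗ₖ Fᴴ) * M * ((1 : Matrix N N ℂ) ⊗ₖ F)) (x, k) (y, k) =
      (Fᴴ * M' * F) k k := by
    intro k
    simp only [Matrix.mul_apply, Fintype.sum_prod_type, Matrix.kroneckerMap_apply,
      Matrix.one_apply, ite_mul, one_mul, zero_mul, mul_ite, mul_zero, M', Matrix.of_apply]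
    rw [Finset.sum_eq_single y]
    · refine Finset.sum_congr rfl fun l _ => ?_
      rw [Finset.sum_eq_single x]
      · simp
      · intro z _ hz
        simp [hz.symm]
      · simp
    · intro z _ hz
      simp [hz]
    · simp
  simp only [trSnd, Matrix.of_apply, h1]
  change (Fᴴ * M' * F).trace = M'.trace
  rw [Matrix.trace_mul_comm, ← Matrix.mul_assoc, hF1, Matrix.one_mul]

theorem sum_rpow_pos {N : Type*} [Fintype N] [DecidableEq N] (α : ℝ) (A : Matrix N N ℂ)
    (hA : A.PosSemidef) (ht : A.trace = 1) : 0 < ∑ i, hA.1.eigenvalues i ^ α := by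
  have h0 := hA.eigenvalues_nonneg
  have h1 : ∑ i, hA.1.eigenvalues i = 1 := by
    have := hA.1.trace_eq_sum_eigenvalues
    rw [ht] at this
    have h2 : ((∑ i, hA.1.eigenvalues i : ℝ) : ℂ) = 1 := by
      rw [this]; push_cast; rfl
    exact_mod_cast h2
  have : ∃ i, 0 < hA.1.eigenvalues i := by
    by_contra hh
    push Not at hh
    rw [Finset.sum_eq_zero (fun i _ => le_antisymm (hh i) (h0 i))] at h1
    exact zero_ne_one h1
  obtain ⟨i, hi⟩ := this
  exact Finset.sum_pos' (fun i _ => Real.rpow_nonneg (h0 i) _)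
    ⟨i, Finset.mem_univ _, Real.rpow_pos_of_pos hi _⟩

/-- Theorem 7: the Rényi entropy production of a catalysis is bounded by the catalytic Rényi
entropy `S_α^◇(σ) = (1/(1−α)) log₂ ∑ᵢ λᵢ^α rᵢ^{2−α}` of the catalyst. -/
theorem stmt13 (α : ℝ) (hα0 : 0 < α) (hα1 : α ≠ 1)
    {dA dB : ℕ} (U : Matrix (Fin dA × Fin dB) (Fin dA × Fin dB) ℂ)
    (hU : IsUnitary U) (σ : Matrix (Fin dB) (Fin dB) ℂ) (hσ : IsDensity σ)
    (hcanon : ∀ ρ : Matrix (Fin dA) (Fin dA) ℂ, IsDensity ρ →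
      trFst (U * (ρ ⊗ₖ σ) * Uᴴ) = σ)
    {n : ℕ} (lam : Fin n → ℝ) (P : Fin n → Matrix (Fin dB) (Fin dB) ℂ) (r : Fin n → ℕ)
    (hdec : σ = ∑ i, (lam i : ℂ) • P i)
    (hdist : Function.Injective lam)
    (hproj : ∀ i, (P i).IsHermitian ∧ P i * P i = P i)
    (horth : ∀ i j, i ≠ j → P i * P j = 0)
    (hres : ∑ i, P i = 1)
    (hrpos : ∀ i, 0 < r i)
    (htr : ∀ i, (P i).trace = (r i : ℂ))
    (m : ℕ) (hm : 0 < m)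
    (ρ : Matrix (Fin m × Fin dA) (Fin m × Fin dA) ℂ) (hρ : IsDensity ρ)
    (ω : Matrix (Fin m × Fin dA) (Fin m × Fin dA) ℂ)
    (hω : ω = trSnd ((extUnitary U : Matrix ((Fin m × Fin dA) × Fin dB)
        ((Fin m × Fin dA) × Fin dB) ℂ) * (ρ ⊗ₖ σ) * (extUnitary U)ᴴ)) :
    renyiEntropy α ω - renyiEntropy α ρ ≤
      (1 - α)⁻¹ * Real.logb 2 (∑ i, lam i ^ α * (r i : ℝ) ^ (2 - α)) := by
  have hdA : 0 < dA := by
    rcases Nat.eq_zero_or_pos dA with h | h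
    · subst h
      have := hρ.2
      simp [Matrix.trace] at this
    · exact h
  have hcom := ext_comm (m := m) U σ (commute_lem U hU σ hσ.1.1 hdA hcanon)
  have hun := ext_unit (m := m) U hU
  obtain ⟨E, hE1, hE2, hE⟩ := spec_data hρ.1.1
  obtain ⟨F, hF1, hF2, hF⟩ := spec_data hσ.1.1
  have hp0 := hρ.1.eigenvalues_nonneg
  have hs0 := hσ.1.eigenvalues_nonneg
  have hTpos := sum_rpow_pos α ρ hρ.1 hρ.2
  have hσpos := sum_rpow_pos 1 σ hσ.1 hσ.2
  set p := hρ.1.1.eigenvalues with hpdef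
  set s := hσ.1.1.eigenvalues with hsdef
  obtain ⟨g, hg, hcard⟩ := count_lem F hF1 hF2 s σ hF lam P r hdec hdist hproj horth hres htr
  set X : Matrix ((Fin m × Fin dA) × Fin dB) ((Fin m × Fin dA) × Fin dB) ℂ := extUnitary U with hX
  let I : Matrix (Fin m × Fin dA) (Fin m × Fin dA) ℂ := 1
  let Z : Matrix ((Fin m × Fin dA) × Fin dB) ((Fin m × Fin dA) × Fin dB) ℂ :=
    (I ⊗ₖ Fᴴ) * X * (E ⊗ₖ F)
  have hZh : Zᴴ = (Eᴴ ⊗ₖ Fᴴ) * Xᴴ * (I ⊗ₖ F) := by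
    simp only [Z, I, Matrix.conjTranspose_mul, Matrix.conjTranspose_kronecker,
      Matrix.conjTranspose_conjTranspose, Matrix.conjTranspose_one, Matrix.mul_assoc]
  have hFF : (I ⊗ₖ F) * (I ⊗ₖ Fᴴ) = 1 := by
    rw [← Matrix.mul_kronecker_mul, hF1]; simp [I]
  have hZ : Zᴴ * Z = 1 := by
    calc Zᴴ * Z = (Eᴴ ⊗ₖ Fᴴ) * (Xᴴ * ((I ⊗ₖ F) * (I ⊗ₖ Fᴴ)) * X) * (E ⊗ₖ F) := by
          rw [hZh]; simp only [Z, Matrix.mul_assoc]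
      _ = 1 := by
          rw [hFF, Matrix.mul_one, hun, Matrix.mul_one, ← Matrix.mul_kronecker_mul, hE2, hF2]
          simp
  let D : Matrix (Fin dB) (Fin dB) ℂ := Matrix.diagonal (fun i => (s i : ℂ))
  have hFD : Fᴴ * σ = D * Fᴴ := by
    rw [hF]; simp only [← Matrix.mul_assoc, hF2, Matrix.one_mul, D]
  have hDF : σ * F = F * D := by
    conv_lhs => rw [hF]
    rw [Matrix.mul_assoc, hF2, Matrix.mul_one]
  have hZD : (I ⊗ₖ D) * Z = Z * (I ⊗ₖ D) := by
    calc (I ⊗ₖ D) * Z = ((I ⊗ₖ D) * (I ⊗ₖ Fᴴ)) * X * (E ⊗ₖ F) := by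
          simp only [Z, Matrix.mul_assoc]
      _ = ((I ⊗ₖ Fᴴ) * (I ⊗ₖ σ)) * X * (E ⊗ₖ F) := by
          rw [← Matrix.mul_kronecker_mul, ← Matrix.mul_kronecker_mul, hFD]
      _ = (I ⊗ₖ Fᴴ) * X * ((I ⊗ₖ σ) * (E ⊗ₖ F)) := by
          rw [Matrix.mul_assoc (I ⊗ₖ Fᴴ), ← hcom]; simp only [Matrix.mul_assoc, I]
      _ = Z * (I ⊗ₖ D) := by
          simp only [Z]
          rw [Matrix.mul_assoc _ (E ⊗ₖ F), ← Matrix.mul_kronecker_mul, ← Matrix.mul_kronecker_mul,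
            hDF]
          simp [I]
  have hID : I ⊗ₖ D = Matrix.diagonal (fun xb : (Fin m × Fin dA) × Fin dB => (s xb.2 : ℂ)) := by
    simp only [I, D]
    rw [← Matrix.diagonal_one, Matrix.diagonal_kronecker_diagonal]
    simp
  have hblk : ∀ x c a b, s c ≠ s b → Z (x, c) (a, b) = 0 := by
    intro x c a b hcb
    rw [hID] at hZD
    have h := congrFun (congrFun hZD (x, c)) (a, b)
    rw [Matrix.diagonal_mul, Matrix.mul_diagonal] at h
    have h2 : ((s c : ℂ) - s b) * Z (x, c) (a, b) = 0 := by linear_combination h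
    rcases mul_eq_zero.1 h2 with h3 | h3
    · exact absurd (by exact_mod_cast sub_eq_zero.1 h3) hcb
    · exact h3
  have hρσ : ρ ⊗ₖ σ = (E ⊗ₖ F) * Matrix.diagonal
      (fun ab : (Fin m × Fin dA) × Fin dB => ((p ab.1 * s ab.2 : ℝ) : ℂ)) * (Eᴴ ⊗ₖ Fᴴ) := by
    rw [hE, hF, Matrix.mul_kronecker_mul, Matrix.mul_kronecker_mul,
      Matrix.diagonal_kronecker_diagonal]
    simp
  have hωZ : ω = trSnd (Z * Matrix.diagonal
      (fun ab : (Fin m × Fin dA) × Fin dB => ((p ab.1 * s ab.2 : ℝ) : ℂ)) * Zᴴ) := by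
    rw [hω, ← trSnd_conj_s13 F hF1, hρσ, hZh]
    simp only [Z, I, Matrix.mul_assoc]
  have hXps : (X * (ρ ⊗ₖ σ) * Xᴴ).PosSemidef :=
    (hρ.1.kronecker hσ.1).mul_mul_conjTranspose_same X
  have hωh : ω.IsHermitian := by
    rw [hω]
    ext x y
    simp only [trSnd, Matrix.conjTranspose_apply, Matrix.of_apply, star_sum]
    exact Finset.sum_congr rfl fun k _ => hXps.1.apply _ _
  obtain ⟨c1, c2⟩ := core α hα0 Z hZ p s hp0 hs0 hblk ω hωh hωZ
  have hcard' : ∀ b, (Finset.univ.filter fun c => s c = s b).card = r (g b) := by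
    intro b
    rw [← hcard (g b)]
    congr 1
    ext c
    simp only [Finset.mem_filter, Finset.mem_univ, true_and, hg]
    exact hdist.eq_iff
  have hC : ∑ b, s b ^ α * ((Finset.univ.filter fun c => s c = s b).card : ℝ) ^ (1 - α) =
      ∑ i, lam i ^ α * (r i : ℝ) ^ (2 - α) := by
    rw [← Finset.sum_fiberwise Finset.univ g]
    refine Finset.sum_congr rfl fun i _ => ?_
    have h1 : ∀ b ∈ Finset.univ.filter (fun b => g b = i),
        s b ^ α * ((Finset.univ.filter fun c => s c = s b).card : ℝ) ^ (1 - α) =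
        lam i ^ α * (r i : ℝ) ^ (1 - α) := by
      intro b hb
      rw [hcard', hg, (Finset.mem_filter.1 hb).2]
    rw [Finset.sum_congr rfl h1, Finset.sum_const, hcard, nsmul_eq_mul]
    have hr : (0 : ℝ) < r i := by exact_mod_cast hrpos i
    rw [show (2 - α) = 1 + (1 - α) by ring, Real.rpow_add hr, Real.rpow_one]
    ring
  rw [hC] at c1 c2
  have hCpos : 0 < ∑ i, lam i ^ α * (r i : ℝ) ^ (2 - α) := by
    rw [← hC]
    have hT2 := sum_rpow_pos α σ hσ.1 hσ.2
    refine Finset.sum_pos' (fun b _ => mul_nonneg (Real.rpow_nonneg (hs0 b) _)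
      (Real.rpow_nonneg (Nat.cast_nonneg _) _)) ?_
    obtain ⟨b, _, hb⟩ := Finset.exists_lt_of_sum_lt (s := Finset.univ)
      (f := fun _ : Fin dB => (0 : ℝ)) (g := fun b => s b ^ (α)) (by simpa using hT2)
    refine ⟨b, Finset.mem_univ _, mul_pos hb (Real.rpow_pos_of_pos ?_ _)⟩
    rw [hcard']
    exact_mod_cast hrpos _
  have hωps : ω.PosSemidef := by
    have e : ω = ∑ k, (X * (ρ ⊗ₖ σ) * Xᴴ).submatrix (fun x => (x, k)) (fun x => (x, k)) := by
      rw [hω]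
      ext x y
      simp only [trSnd, Matrix.of_apply, Matrix.sum_apply, Matrix.submatrix_apply]
    rw [e]
    exact Matrix.posSemidef_sum _ fun k _ => hXps.submatrix _
  have hωt : ω.trace = 1 := by
    have e : ω.trace = (X * (ρ ⊗ₖ σ) * Xᴴ).trace := by
      rw [hω]
      simp only [trSnd, Matrix.trace, Matrix.diag_apply, Matrix.of_apply,
        Fintype.sum_prod_type]
    rw [e, Matrix.trace_mul_comm, ← Matrix.mul_assoc, hun, Matrix.one_mul,
      Matrix.trace_kronecker, hρ.2, hσ.2, mul_one]
  have hSpos : 0 < ∑ i, hωh.eigenvalues i ^ α := sum_rpow_pos α ω hωps hωt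
  have hlog := Real.logb_mul (b := 2) hTpos.ne' hCpos.ne'
  rw [renyiEntropy, renyiEntropy, dif_pos hωh, dif_pos hρ.1.1, ← mul_sub]
  rcases lt_or_gt_of_ne hα1 with h | h
  · have h1 := Real.logb_le_logb_of_le (b := 2) (by norm_num) hSpos (c1 h.le)
    refine mul_le_mul_of_nonneg_left ?_ (inv_nonneg.2 (by linarith))
    linarith
  · have h1 := Real.logb_le_logb_of_le (b := 2) (by norm_num) (mul_pos hTpos hCpos) (c2 h.le)
    refine mul_le_mul_of_nonpos_left ?_ (inv_nonpos.2 (by linarith))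
    linarith
end
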